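/- (Strong-condition version with strict localization) Let K₁, K₂ be cones in normed linear spaces X, Y, K = K₁ × K₂, and let r = (r₁,r₂), R = (R₁,R₂) with 0 < rᵢ < Rᵢ (i = 1,2). Assume T = (T₁,T₂) : K̄_{r,R} → K is a compact map and for each i ∈ {1,2} there exists hᵢ ∈ Kᵢ \ {0} such that one of the following holds for all x = (x₁,x₂) ∈ K̄_{r,R}: (a†) Tᵢx + μhᵢ ≠ xᵢ whenever ‖xᵢ‖ = rᵢ and μ ≥ 0, and Tᵢx ≠ λxᵢ whenever ‖xᵢ‖ = Rᵢ and λ ≥ 1; or (b†) Tᵢx ≠ λxᵢ whenever ‖xᵢ‖ = rᵢ and λ ≥ 1, and Tᵢx + μhᵢ ≠ xᵢ whenever ‖xᵢ‖ = Rᵢ and μ ≥ 0. Then T has at least one fixed point x̄ = (x̄₁,x̄₂) ∈ K with rᵢ < ‖x̄ᵢ‖ < Rᵢ for i = 1,2. -/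

import Mathlib

open Set

/-- A cone in a normed linear space: a nonempty closed convex set, invariant under
multiplication by nonnegative scalars, with `K ∩ (-K) = {0}`. -/
def IsCone {X : Type*} [NormedAddCommGroup X] [NormedSpace ℝ X] (K : Set X) : Prop :=
  K.Nonempty ∧ IsClosed K ∧ Convex ℝ K ∧
    (∀ u ∈ K, ∀ c : ℝ, 0 ≤ c → c • u ∈ K) ∧ K ∩ (-K) = {0}

/-- The set `K̄_{r,R} = {(x₁,x₂) ∈ K₁ × K₂ : rᵢ ≤ ‖xᵢ‖ ≤ Rᵢ}`. -/
def KrR {X Y : Type*} [NormedAddCommGroup X] [NormedAddCommGroup Y]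
    (K₁ : Set X) (K₂ : Set Y) (r₁ r₂ R₁ R₂ : ℝ) : Set (X × Y) :=
  {p | p.1 ∈ K₁ ∧ p.2 ∈ K₂ ∧ r₁ ≤ ‖p.1‖ ∧ ‖p.1‖ ≤ R₁ ∧ r₂ ≤ ‖p.2‖ ∧ ‖p.2‖ ≤ R₂}

theorem det_one_add_eq_sum_lagrange {E : Type*} [AddCommGroup E] [Module ℝ E]
    [FiniteDimensional ℝ E] {s : Finset ℝ} (hs : Module.finrank ℝ E < s.card) (A : E →ₗ[ℝ] E) :
    LinearMap.det (1 + A) =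
      ∑ t ∈ s, LinearMap.det (1 + t • A) * (Lagrange.basis s id t).eval 1 := by
  classical
  let b := Module.finBasis ℝ E
  let M := LinearMap.toMatrix b b A
  let p : Polynomial ℝ :=
    Matrix.det ((Polynomial.X : Polynomial ℝ) • M.map Polynomial.C
      + (1 : Matrix _ _ ℝ).map Polynomial.C)
  have hp : ∀ t : ℝ, p.eval t = LinearMap.det (1 + t • A) := by
    intro t
    rw [← LinearMap.det_toMatrix b, ← Polynomial.coe_evalRingHom, RingHom.map_det]
    congr 1
    ext i j
    simp [M, Matrix.one_apply, LinearMap.toMatrix_one, add_comm]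
    split_ifs <;> simp [mul_comm]
  have hdeg : p.degree < s.card := by
    refine lt_of_le_of_lt Polynomial.degree_le_natDegree ?_
    have h := Polynomial.natDegree_det_X_add_C_le M 1
    rw [Fintype.card_fin] at h
    exact_mod_cast h.trans_lt hs
  have h := Lagrange.eq_interpolate (s := s) (v := id) (f := p) (Set.injOn_id _) hdeg
  have h1 := congrArg (Polynomial.eval 1) h
  rw [hp, one_smul, Lagrange.interpolate_apply, Polynomial.eval_finsetSum] at h1
  simpa [hp] using h1

theorem image_eq_of_bijective_of_forall_notMem_eq {α : Type*} {g : α → α}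
    (hg : Function.Bijective g) {s : Set α}
    (h : ∀ x ∉ s, g x = x) : g '' s = s := by
  ext y
  constructor
  · rintro ⟨x, hx, rfl⟩
    by_contra hy
    exact hy (by rwa [hg.1 (h _ hy)])
  · intro hy
    obtain ⟨x, rfl⟩ := hg.2 y
    by_cases hx : x ∈ s
    · exact ⟨x, hx, rfl⟩
    · rw [h x hx] at hy
      exact absurd hy hx

section Retraction

open Metric MeasureTheory

variable {E : Type*} [NormedAddCommGroup E]

theorem lipschitzWith_indicator_ball_of_sphere_eq_zero [NormedSpace ℝ E] {u : E → E} {R : ℝ}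
    {C : NNReal} (hu : LipschitzOnWith C u (closedBall 0 R)) (h0 : ∀ x, ‖x‖ = R → u x = 0) :
    LipschitzWith C ((ball 0 R).indicator u) := by
  have key : ∀ x ∈ ball (0 : E) R, ∀ y ∉ ball (0 : E) R, ‖u x‖ ≤ C * dist x y := by
    intro x hx y hy
    rw [mem_ball_zero_iff] at hx hy
    have hc : Continuous (fun s : ℝ => ‖AffineMap.lineMap x y s‖) :=
      (AffineMap.lineMap_continuous).norm
    obtain ⟨s, hs, hsR⟩ := intermediate_value_Icc (zero_le_one' ℝ) hc.continuousOn
      (show R ∈ Icc _ _ by simpa using ⟨hx.le, not_lt.1 hy⟩)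
    have h1 := hu.dist_le_mul x (by simpa using hx.le) (AffineMap.lineMap x y s)
      (by simpa using hsR.le)
    rw [h0 _ hsR, dist_zero_right, dist_left_lineMap, Real.norm_of_nonneg hs.1] at h1
    refine h1.trans ?_
    gcongr
    exact mul_le_of_le_one_left dist_nonneg hs.2
  refine LipschitzWith.of_dist_le_mul fun x y => ?_
  by_cases hx : x ∈ ball (0 : E) R <;> by_cases hy : y ∈ ball (0 : E) R
  · simpa [hx, hy] using hu.dist_le_mul x (ball_subset_closedBall hx) y (ball_subset_closedBall hy)
  · simpa [indicator_of_mem hx, indicator_of_notMem hy] using key x hx y hy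
  · rw [dist_comm, dist_comm x]
    simpa [indicator_of_mem hy, indicator_of_notMem hx] using key y hy x hx
  · simp only [indicator_of_notMem hx, indicator_of_notMem hy, dist_self]
    positivity

theorem bijective_add_smul_of_lipschitz [NormedSpace ℝ E] [CompleteSpace E] {v : E → E}
    {C : NNReal} (hv : LipschitzWith C v) {t : ℝ} (ht : |t| * C < 1) :
    Function.Bijective (fun x => x + t • v x) := by
  have happ : ApproximatesLinearOn (fun x => x + t • v x)
      ((ContinuousLinearEquiv.refl ℝ E : E ≃L[ℝ] E) : E →L[ℝ] E) univ (‖t‖₊ * C) := by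
    intro x _ y _
    have := hv.dist_le_mul x y
    rw [dist_eq_norm, dist_eq_norm] at this
    have e : x + t • v x - (y + t • v y)
        - ((ContinuousLinearEquiv.refl ℝ E : E ≃L[ℝ] E) : E →L[ℝ] E) (x - y)
        = t • (v x - v y) := by
      simp [smul_sub]; abel
    rw [e, norm_smul]
    push_cast
    rw [mul_assoc]
    gcongr
  have hc : Subsingleton E ∨ ‖t‖₊ * C <
      ‖((ContinuousLinearEquiv.refl ℝ E).symm : E →L[ℝ] E)‖₊⁻¹ := by
    rcases subsingleton_or_nontrivial E with h | h
    · exact Or.inl h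
    · right
      have : ‖((ContinuousLinearEquiv.refl ℝ E).symm : E →L[ℝ] E)‖₊ = 1 := by
        rw [← NNReal.coe_inj]; exact ContinuousLinearMap.norm_id
      rw [this, inv_one, ← NNReal.coe_lt_coe]
      simpa using ht
  exact ⟨injOn_univ.1 (happ.injOn hc), happ.surjective hc⟩

variable [InnerProductSpace ℝ E] [FiniteDimensional ℝ E]

theorem no_contDiff_retraction_onto_sphere {f : E → E} (hf : ContDiff ℝ 1 f) {R : ℝ} (hR : 0 < R)
    (hid : ∀ x, ‖x‖ = R → f x = x) (hnorm : ∀ x, ‖f x‖ = R) : False := by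
  borelize E
  set u : E → E := fun x => f x - x with hu
  have hu1 : ContDiff ℝ 1 u := hf.sub contDiff_id
  have hud : ∀ x, HasFDerivAt u (fderiv ℝ u x) x := fun x =>
    (hu1.differentiable one_ne_zero x).hasFDerivAt
  have hfd : ∀ x, HasFDerivAt f (1 + fderiv ℝ u x) x := by
    intro x
    have := (hasFDerivAt_id (𝕜 := ℝ) x).add (hud x)
    refine this.congr_of_eventuallyEq (Filter.Eventually.of_forall fun y => ?_)
    simp [hu]
  have hdet0 : ∀ x, LinearMap.det (1 + (fderiv ℝ u x : E →ₗ[ℝ] E)) = 0 := by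
    intro x
    by_contra hne
    have hsurj : Function.Surjective ((1 : E →ₗ[ℝ] E) + (fderiv ℝ u x : E →ₗ[ℝ] E)) := by
      have := LinearMap.range_eq_top.1 ((LinearMap.equivOfDetNeZero _ hne).range)
      exact this
    obtain ⟨w, hw⟩ := hsurj (f x)
    have h1 : HasFDerivAt (fun y => ‖f y‖ ^ 2)
      (2 • (innerSL ℝ (f x)).comp (1 + fderiv ℝ u x)) x := (hfd x).norm_sq
    have h2 : HasFDerivAt (fun y => ‖f y‖ ^ 2) (0 : E →L[ℝ] ℝ) x := by
      simp only [hnorm]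
      exact hasFDerivAt_const _ _
    have h3 := congrArg (fun L : E →L[ℝ] ℝ => L w) (h1.unique h2)
    have hw' : (1 + fderiv ℝ u x) w = f x := hw
    simp only [smul_apply, ContinuousLinearMap.comp_apply, hw',
      zero_apply, innerSL_apply_apply, real_inner_self_eq_norm_sq, hnorm] at h3
    simp at h3
    exact hR.ne' h3
  have hcomp := isCompact_closedBall (0 : E) R
  obtain ⟨C, hC⟩ := hu1.contDiffOn.exists_lipschitzOnWith one_ne_zero
    (convex_closedBall (0 : E) R) hcomp
  have hv := lipschitzWith_indicator_ball_of_sphere_eq_zero hC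
    (fun x hx => by simp [hu, hid x hx])
  have hcu : Continuous (fderiv ℝ u) := hu1.continuous_fderiv one_ne_zero
  obtain ⟨D, hD⟩ := hcomp.exists_bound_of_continuousOn hcu.continuousOn
  have hcdet : Continuous (fun A : E →L[ℝ] E => A.det) := ContinuousLinearMap.continuous_det
  have hdet_pos : ∀ᶠ A in nhds (1 : E →L[ℝ] E), 0 < A.det := by
    have : (0 : ℝ) < (1 : E →L[ℝ] E).det := by
      rw [ContinuousLinearMap.det]; simp
    exact hcdet.continuousAt.eventually (lt_mem_nhds this)
  obtain ⟨δ, hδ, hδdet⟩ := Metric.eventually_nhds_iff.1 hdet_pos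
  -- for small `t`, the map `x ↦ x + t • v x` preserves volume of the ball
  have hvol : ∀ t : ℝ, |t| * C < 1 → |t| * D < δ →
      IntegrableOn (fun x => LinearMap.det (1 + t • (fderiv ℝ u x : E →ₗ[ℝ] E))) (ball 0 R) ∧
      ∫ x in ball (0 : E) R, LinearMap.det (1 + t • (fderiv ℝ u x : E →ₗ[ℝ] E)) =
        (volume : Measure E).real (ball 0 R) := by
    intro t htC htD
    have hbij := bijective_add_smul_of_lipschitz hv htC
    have himg := image_eq_of_bijective_of_forall_notMem_eq hbij (s := ball 0 R)
      (fun x hx => by simp [indicator_of_notMem hx])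
    have hder : ∀ x ∈ ball (0 : E) R, HasFDerivWithinAt
        (fun x => x + t • (ball (0 : E) R).indicator u x) (1 + t • fderiv ℝ u x) (ball 0 R) x := by
      intro x hx
      refine HasFDerivWithinAt.congr (f := fun x => x + t • u x) ?_ ?_ ?_
      · exact ((hasFDerivAt_id x).add ((hud x).const_smul t)).hasFDerivWithinAt
      · intro y hy; simp [indicator_of_mem hy]
      · simp [indicator_of_mem hx]
    have hcv := integral_image_eq_integral_abs_det_fderiv_smul (volume : Measure E)
      measurableSet_ball hder hbij.1.injOn (fun _ => (1 : ℝ))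
    rw [himg] at hcv
    constructor
    · have : Continuous (fun x => (1 + t • fderiv ℝ u x : E →L[ℝ] E).det) :=
        hcdet.comp (by fun_prop)
      exact (this.continuousOn.integrableOn_compact hcomp).mono_set ball_subset_closedBall
    · simp only [integral_const, smul_eq_mul, mul_one, measureReal_restrict_apply_univ] at hcv
      rw [hcv]
      refine setIntegral_congr_fun measurableSet_ball fun x hx => ?_
      have hpos : 0 < (1 + t • fderiv ℝ u x : E →L[ℝ] E).det := by
        apply hδdet
        rw [dist_eq_norm, add_sub_cancel_left, norm_smul, Real.norm_eq_abs]
        refine lt_of_le_of_lt ?_ htD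
        gcongr
        exact hD x (ball_subset_closedBall hx)
      exact (abs_of_pos hpos).symm
  -- nodes of interpolation
  obtain ⟨η, hη, hηC, hηD⟩ : ∃ η : ℝ, 0 < η ∧ η * C < 1 ∧ η * |D| < δ := by
    refine ⟨min 1 δ / (2 * (C + |D| + 1)), by positivity, ?_, ?_⟩
    · rw [div_mul_eq_mul_div, div_lt_one (by positivity)]
      have : min 1 δ * C ≤ 1 * C := by gcongr; exact min_le_left _ _
      nlinarith [abs_nonneg D, C.2]
    · rw [div_mul_eq_mul_div, div_lt_iff₀ (by positivity)]
      have : min 1 δ * |D| ≤ δ * |D| := by gcongr; exact min_le_right _ _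
      have h2 : 0 ≤ δ * C := by positivity
      nlinarith [mul_nonneg hδ.le (abs_nonneg D)]
  obtain ⟨s, hsub, hcard⟩ := (Set.Ioo_infinite hη).exists_subset_card_eq (Module.finrank ℝ E + 1)
  have hlt : Module.finrank ℝ E < s.card := by omega
  have hnode : ∀ t ∈ s, |t| * C < 1 ∧ |t| * D < δ := by
    intro t ht
    obtain ⟨h1, h2⟩ := hsub ht
    rw [abs_of_pos h1]
    constructor
    · refine lt_of_le_of_lt ?_ hηC; gcongr
    · refine lt_of_le_of_lt ?_ hηD
      exact (mul_le_mul_of_nonneg_left (le_abs_self D) h1.le).trans (by gcongr)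
  have hint : ∫ x in ball (0 : E) R, LinearMap.det (1 + (fderiv ℝ u x : E →ₗ[ℝ] E)) =
      (volume : Measure E).real (ball 0 R) := by
    rw [setIntegral_congr_fun measurableSet_ball fun x _ => det_one_add_eq_sum_lagrange hlt _]
    rw [integral_finsetSum]
    · have h1 := det_one_add_eq_sum_lagrange hlt (0 : E →ₗ[ℝ] E)
      simp only [smul_zero, add_zero, map_one, one_mul] at h1
      refine Eq.trans ?_ (mul_one _)
      conv_rhs => rw [h1, Finset.mul_sum]
      refine Finset.sum_congr rfl fun t ht => ?_
      rw [integral_mul_const, (hvol t (hnode t ht).1 (hnode t ht).2).2]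
    · intro t ht
      exact (hvol t (hnode t ht).1 (hnode t ht).2).1.mul_const _
  simp only [hdet0, integral_zero] at hint
  have : 0 < (volume : Measure E).real (ball 0 R) :=
    ENNReal.toReal_pos (measure_ball_pos _ _ hR).ne' measure_ball_lt_top.ne
  exact this.ne hint

end Retraction

section Brouwer

open Metric Filter Topology

variable {E : Type*} [NormedAddCommGroup E] [InnerProductSpace ℝ E] [FiniteDimensional ℝ E]

theorem exists_fixedPoint_of_contDiff_of_bounded {F : E → E} (hF : ContDiff ℝ 1 F) {M : ℝ}
    (hM : ∀ x, ‖F x‖ ≤ M) : ∃ x, F x = x := by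
  by_contra! hne
  have hM0 : 0 ≤ M := (norm_nonneg _).trans (hM 0)
  let φ : ContDiffBump (0 : E) := ⟨M + 1, M + 2, by linarith, by linarith⟩
  let w : E → E := fun x => x - φ x • F x
  have hw : ContDiff ℝ 1 w := contDiff_id.sub (φ.contDiff.smul hF)
  have hw0 : ∀ x, w x ≠ 0 := by
    intro x hx
    rw [sub_eq_zero] at hx
    by_cases hxM : x ∈ closedBall (0 : E) (M + 1)
    · rw [φ.one_of_mem_closedBall hxM, one_smul] at hx
      exact hne x hx.symm
    · have h1 : ‖x‖ ≤ M := by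
        rw [hx, norm_smul, Real.norm_of_nonneg φ.nonneg]
        exact (mul_le_of_le_one_left (norm_nonneg _) φ.le_one).trans (hM x)
      rw [mem_closedBall_zero_iff] at hxM
      linarith
  refine no_contDiff_retraction_onto_sphere (f := fun x => ((M + 2) * ‖w x‖⁻¹) • w x)
    (R := M + 2) ?_ (by linarith) ?_ ?_
  · exact (contDiff_const.mul ((hw.norm ℝ hw0).inv fun x => norm_ne_zero_iff.2 (hw0 x))).smul hw
  · intro x hx
    have : φ x = 0 := φ.zero_of_le_dist (by rw [dist_zero_right, hx])
    simp only [w, this, zero_smul, sub_zero, hx]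
    rw [mul_inv_cancel₀ (by linarith), one_smul]
  · intro x
    rw [norm_smul, norm_mul, norm_inv, norm_norm, mul_assoc,
      inv_mul_cancel₀ (norm_ne_zero_iff.2 (hw0 x)), mul_one, Real.norm_of_nonneg (by linarith)]

theorem exists_fixedPoint_of_continuous_of_bounded {F : E → E} (hF : Continuous F) {M : ℝ}
    (hM : ∀ x, ‖F x‖ ≤ M) : ∃ x, F x = x := by
  have happrox : ∀ n : ℕ, ∃ x, ‖x‖ ≤ M + 1 ∧ dist x (F x) ≤ 1 / ((n : ℝ) + 1) := by
    intro n
    obtain ⟨G, hG, hGF, -⟩ := hF.exists_contDiff_approx (ε := fun _ => 1 / ((n : ℝ) + 1)) 1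
      continuous_const (fun _ => Nat.one_div_pos_of_nat)
    have hle : 1 / ((n : ℝ) + 1) ≤ 1 := by
      rw [div_le_one (by positivity)]; linarith [n.cast_nonneg (α := ℝ)]
    have hGM : ∀ x, ‖G x‖ ≤ M + 1 := by
      intro x
      have h1 := hGF x
      rw [dist_eq_norm] at h1
      have h2 := norm_le_norm_add_norm_sub' (G x) (F x)
      linarith [hM x]
    obtain ⟨x, hx⟩ := exists_fixedPoint_of_contDiff_of_bounded hG hGM
    refine ⟨x, hx ▸ hGM x, ?_⟩
    have := (hGF x).le
    rwa [hx] at this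
  choose x hxM hx using happrox
  obtain ⟨a, -, φ, hφ, ha⟩ := (isCompact_closedBall (0 : E) (M + 1)).tendsto_subseq
    (x := x) (fun n => by simpa using hxM n)
  refine ⟨a, ?_⟩
  have h1 : Tendsto (fun n => dist (x (φ n)) (F (x (φ n)))) atTop (𝓝 (dist a (F a))) :=
    ha.dist ((hF.tendsto a).comp ha)
  have h2 : Tendsto (fun n => dist (x (φ n)) (F (x (φ n)))) atTop (𝓝 0) :=
    squeeze_zero (fun _ => dist_nonneg) (fun n => hx (φ n))
      (tendsto_one_div_add_atTop_nhds_zero_nat.comp hφ.tendsto_atTop)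
  exact (dist_eq_zero.1 (tendsto_nhds_unique h1 h2)).symm

end Brouwer

section Simplex

variable {ι : Type*} [Fintype ι]

/-- A retraction of `ι → ℝ` onto the standard simplex. -/
noncomputable def simplexRetract (x : ι → ℝ) : ι → ℝ := fun i =>
  (max (x i) 0 + max (1 - ∑ j, max (x j) 0) 0 / Fintype.card ι) / max 1 (∑ j, max (x j) 0)

theorem continuous_simplexRetract : Continuous (simplexRetract : (ι → ℝ) → ι → ℝ) := by
  refine continuous_pi fun i => Continuous.div (by fun_prop) (by fun_prop) fun x => ?_
  exact (lt_of_lt_of_le one_pos (le_max_left _ _)).ne'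

theorem simplexRetract_mem [Nonempty ι] (x : ι → ℝ) : simplexRetract x ∈ stdSimplex ℝ ι := by
  have hpos : 0 < max 1 (∑ j, max (x j) 0) := lt_of_lt_of_le one_pos (le_max_left _ _)
  refine ⟨fun i => by unfold simplexRetract; positivity, ?_⟩
  unfold simplexRetract
  rw [← Finset.sum_div, Finset.sum_add_distrib, Finset.sum_const, Finset.card_univ, nsmul_eq_mul,
    mul_div_cancel₀ _ (by positivity), div_eq_one_iff_eq hpos.ne']
  rcases le_total 1 (∑ j, max (x j) 0) with h | h
  · rw [max_eq_right h, max_eq_right (by linarith), add_zero]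
  · rw [max_eq_left h, max_eq_left (by linarith)]; ring

theorem simplexRetract_of_mem {x : ι → ℝ} (hx : x ∈ stdSimplex ℝ ι) : simplexRetract x = x := by
  have h : ∀ j, max (x j) 0 = x j := fun j => max_eq_left (hx.1 j)
  ext i
  simp [simplexRetract, h, hx.2]

theorem exists_fixedPoint_stdSimplex [Nonempty ι] {g : (ι → ℝ) → ι → ℝ}
    (hg : ContinuousOn g (stdSimplex ℝ ι)) (hmaps : MapsTo g (stdSimplex ℝ ι) (stdSimplex ℝ ι)) :
    ∃ x ∈ stdSimplex ℝ ι, g x = x := by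
  let F : EuclideanSpace ℝ ι → EuclideanSpace ℝ ι :=
    fun x => WithLp.toLp 2 (g (simplexRetract (WithLp.ofLp x)))
  have hc : Continuous F := by
    refine (PiLp.continuous_toLp 2 _).comp ?_
    exact hg.comp_continuous (continuous_simplexRetract.comp (PiLp.continuous_ofLp 2 _))
      fun x => simplexRetract_mem _
  obtain ⟨M, hM⟩ := ((isCompact_stdSimplex ℝ ι).image
    (PiLp.continuous_toLp 2 (fun _ : ι => ℝ))).isBounded.exists_norm_le
  obtain ⟨x, hx⟩ := exists_fixedPoint_of_continuous_of_bounded hc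
    (fun x => hM _ ⟨_, hmaps (simplexRetract_mem _), rfl⟩)
  have hx' : g (simplexRetract (WithLp.ofLp x)) = WithLp.ofLp x := congrArg WithLp.ofLp hx
  have hmem : WithLp.ofLp x ∈ stdSimplex ℝ ι := hx' ▸ hmaps (simplexRetract_mem _)
  exact ⟨_, hmem, by rwa [simplexRetract_of_mem hmem] at hx'⟩

end Simplex

section Schauder

open Metric Filter Topology

variable {E : Type*} [NormedAddCommGroup E] [NormedSpace ℝ E]

theorem exists_approx_fixedPoint {C S : Set E} (hC : Convex ℝ C) (hne : C.Nonempty)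
    (hS : IsCompact S) (hSC : S ⊆ C) {f : E → E} (hf : ContinuousOn f C) (hfS : MapsTo f C S)
    {ε : ℝ} (hε : 0 < ε) : ∃ x ∈ C, dist x (f x) ≤ ε := by
  obtain ⟨t, htS, htf, hcov⟩ := hS.finite_cover_balls hε
  have := htf.fintype
  -- weights of the Schauder projection
  let m : t → E → ℝ := fun i z => max (ε - dist z i) 0
  have hm : ∀ i, Continuous (m i) := fun i => by fun_prop
  have hm0 : ∀ i z, 0 ≤ m i z := fun i z => le_max_right _ _
  have hpos : ∀ z ∈ S, 0 < ∑ i, m i z := by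
    intro z hz
    obtain ⟨y, hy, hzy⟩ := mem_iUnion₂.1 (hcov hz)
    refine Finset.sum_pos' (fun i _ => hm0 i z) ⟨⟨y, hy⟩, Finset.mem_univ _, ?_⟩
    exact lt_max_of_lt_left (sub_pos.2 (mem_ball.1 hzy))
  obtain ⟨c, hc⟩ := hne
  obtain ⟨y₀, hy₀, -⟩ := mem_iUnion₂.1 (hcov (hfS hc))
  have : Nonempty t := ⟨⟨y₀, hy₀⟩⟩
  let comb : (t → ℝ) → E := fun a => ∑ i, a i • (i : E)
  have hcomb : Continuous comb := by fun_prop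
  have hcombC : ∀ a ∈ stdSimplex ℝ t, comb a ∈ C := fun a ha =>
    hC.sum_mem (fun i _ => ha.1 i) ha.2 fun i _ => hSC (htS i.2)
  let g : (t → ℝ) → t → ℝ := fun a i => m i (f (comb a)) / ∑ j, m j (f (comb a))
  have hfc : ContinuousOn (fun a => f (comb a)) (stdSimplex ℝ t) :=
    hf.comp hcomb.continuousOn hcombC
  have hgc : ContinuousOn g (stdSimplex ℝ t) := by
    refine continuousOn_pi.2 fun i => ContinuousOn.div ((hm i).comp_continuousOn hfc)
      ?_ fun a ha => (hpos _ (hfS (hcombC a ha))).ne'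
    exact continuousOn_finsetSum _ fun j _ => (hm j).comp_continuousOn hfc
  obtain ⟨a, ha, hga⟩ := exists_fixedPoint_stdSimplex hgc (fun a ha =>
    ⟨fun i => div_nonneg (hm0 _ _) (Finset.sum_nonneg fun j _ => hm0 _ _), by
      rw [← Finset.sum_div, div_self (hpos _ (hfS (hcombC a ha))).ne']⟩)
  refine ⟨comb a, hcombC a ha, ?_⟩
  have hsub : comb a - f (comb a) = ∑ i, a i • ((i : E) - f (comb a)) := by
    simp only [smul_sub, Finset.sum_sub_distrib, ← Finset.sum_smul, ha.2, one_smul, comb]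
  rw [dist_eq_norm, hsub]
  calc ‖∑ i, a i • ((i : E) - f (comb a))‖ ≤ ∑ i, a i * ε := by
        refine norm_sum_le_of_le _ fun i _ => ?_
        rw [norm_smul, Real.norm_of_nonneg (ha.1 i)]
        by_cases hi : dist (f (comb a)) i < ε
        · have h0 := ha.1 i
          rw [← dist_eq_norm, dist_comm]
          gcongr
        · have hmi : m i (f (comb a)) = 0 := max_eq_right (by linarith)
          have : a i = 0 := by rw [← congrFun hga i]; simp [g, hmi]
          simp [this]
    _ = ε := by rw [← Finset.sum_mul, ha.2, one_mul]

/-- **Schauder's fixed point theorem** for a continuous self-map of a convex set whose range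
lies in a compact subset. -/
theorem exists_fixedPoint_of_convex_of_mapsTo_compact {C S : Set E} (hC : Convex ℝ C)
    (hne : C.Nonempty) (hS : IsCompact S) (hSC : S ⊆ C) {f : E → E} (hf : ContinuousOn f C)
    (hfS : MapsTo f C S) : ∃ x ∈ C, f x = x := by
  choose x hxC hx using fun n : ℕ =>
    exists_approx_fixedPoint hC hne hS hSC hf hfS (ε := 1 / ((n : ℝ) + 1)) Nat.one_div_pos_of_nat
  obtain ⟨a, haS, φ, hφ, ha⟩ := hS.tendsto_subseq (fun n => hfS (hxC n))
  have h0 : Tendsto (fun n => dist (x (φ n)) (f (x (φ n)))) atTop (𝓝 0) :=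
    squeeze_zero (fun _ => dist_nonneg) (fun n => hx (φ n))
      (tendsto_one_div_add_atTop_nhds_zero_nat.comp hφ.tendsto_atTop)
  have hxa : Tendsto (fun n => x (φ n)) atTop (𝓝 a) := (tendsto_iff_of_dist h0).2 ha
  have hxa' : Tendsto (fun n => x (φ n)) atTop (𝓝[C] a) :=
    tendsto_nhdsWithin_iff.2 ⟨hxa, Eventually.of_forall fun n => hxC _⟩
  exact ⟨a, hSC haS, tendsto_nhds_unique ((hf a (hSC haS)).tendsto.comp hxa') ha⟩

end Schauder

section Cone

open Metric Filter Topology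

variable {X : Type*} [NormedAddCommGroup X] [NormedSpace ℝ X] {K : Set X}

theorem IsCone.smul_mem (hK : IsCone K) {x : X} (hx : x ∈ K) {c : ℝ} (hc : 0 ≤ c) : c • x ∈ K :=
  hK.2.2.2.1 x hx c hc

theorem IsCone.add_mem (hK : IsCone K) {x y : X} (hx : x ∈ K) (hy : y ∈ K) : x + y ∈ K := by
  have h := hK.2.2.1 hx hy (by norm_num : (0 : ℝ) ≤ 1 / 2) (by norm_num : (0 : ℝ) ≤ 1 / 2)
    (by norm_num)
  have h2 := hK.smul_mem h zero_le_two
  rwa [smul_add, smul_smul, smul_smul, mul_one_div_cancel two_ne_zero, one_smul, one_smul] at h2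

theorem IsCone.eq_zero_of_add_eq_zero (hK : IsCone K) {x y : X} (hx : x ∈ K) (hy : y ∈ K)
    (h : x + y = 0) : x = 0 := by
  have : x ∈ K ∩ (-K) := ⟨hx, by rwa [Set.mem_neg, neg_eq_of_add_eq_zero_right h]⟩
  rwa [hK.2.2.2.2] at this

theorem IsCone.convex_inter_closedBall (hK : IsCone K) (R : ℝ) :
    Convex ℝ (K ∩ closedBall 0 R) :=
  hK.2.2.1.inter (convex_closedBall 0 R)

/-- A cone containing a nonzero vector retracts onto its part outside an open ball about `0`,
without enlarging the norm beyond the radius of that ball. -/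
theorem IsCone.exists_retraction (hK : IsCone K) {h : X} (hh : h ∈ K) (hh0 : h ≠ 0) {r : ℝ}
    (hr : 0 < r) : ∃ ρ : X → X, ContinuousOn ρ K ∧ (∀ x ∈ K, ρ x ∈ K ∧ ‖ρ x‖ = max r ‖x‖) ∧
      ∀ x, r ≤ ‖x‖ → ρ x = x := by
  let y : X → X := fun x => x + max (r - ‖x‖) 0 • h
  have hyc : Continuous y := by fun_prop
  have hyK : ∀ x ∈ K, y x ∈ K := fun x hx => hK.add_mem hx (hK.smul_mem hh (le_max_right _ _))
  have hyr : ∀ x, r ≤ ‖x‖ → y x = x := fun x hx => by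
    simp [y, max_eq_right (sub_nonpos.2 hx)]
  have hy0 : ∀ x ∈ K, y x ≠ 0 := by
    intro x hx h0
    have hx0 := hK.eq_zero_of_add_eq_zero hx (hK.smul_mem hh (le_max_right _ _)) h0
    simp [y, hx0, max_eq_left hr.le, hr.ne', hh0] at h0
  refine ⟨fun x => (max r ‖x‖ / ‖y x‖) • y x, ?_, fun x hx => ⟨?_, ?_⟩, fun x hx => ?_⟩
  · refine ContinuousOn.smul (ContinuousOn.div (by fun_prop) (by fun_prop) ?_) hyc.continuousOn
    exact fun x hx => norm_ne_zero_iff.2 (hy0 x hx)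
  · exact hK.smul_mem (hyK x hx) (by positivity)
  · rw [norm_smul, norm_div, norm_norm, div_mul_cancel₀ _ (norm_ne_zero_iff.2 (hy0 x hx)),
      Real.norm_of_nonneg (by positivity)]
  · simp only [hyr x hx, max_eq_right hx]
    rw [div_self (by linarith), one_smul]

/-- A compact map into a cone that satisfies compression conditions along `p` can be modified to
a compact map into the part of the cone in a ball, all of whose coincidence points with `p` are
coincidence points of the original map outside the inner ball. -/
theorem IsCone.exists_modification_of_compression {E : Type*} [TopologicalSpace E] {C : Set E}
    {p A : E → X} (hK : IsCone K) {h : X} (hh : h ∈ K) (hh0 : h ≠ 0) {r R : ℝ}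
    (hr : 0 < r) (hrR : r < R) (hp : ContinuousOn p C) (hA : ContinuousOn A C)
    {S : Set X} (hS : IsCompact S) (hSK : S ⊆ K) (hAS : MapsTo A C S)
    (hin : ∀ x ∈ C, ‖p x‖ = r → ∀ μ : ℝ, 0 ≤ μ → A x + μ • h ≠ p x)
    (hout : ∀ x ∈ C, ‖p x‖ = R → ∀ l : ℝ, 1 ≤ l → A x ≠ l • p x) :
    ∃ (N : E → X) (S' : Set X), ContinuousOn N C ∧ IsCompact S' ∧ S' ⊆ K ∩ closedBall 0 R ∧
      MapsTo N C S' ∧ ∀ x ∈ C, N x = p x → r ≤ ‖p x‖ ∧ A x = p x := by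
  obtain ⟨B, hB⟩ := hS.isBounded.exists_norm_le
  have hhpos : 0 < ‖h‖ := norm_pos_iff.2 hh0
  let ray : Set X := (fun c : ℝ => c • h) '' Ici 0
  have hray : IsClosed ray := isClosedMap_smul_left h _ isClosed_Ici
  have hray0 : ray.Nonempty := nonempty_Ici.image _
  let d : E → ℝ := fun x => infDist (p x - A x) ray
  have hd : ContinuousOn d C := (continuous_infDist_pt ray).comp_continuousOn (hp.sub hA)
  have hd0 : ∀ x, 0 ≤ d x := fun x => infDist_nonneg
  let φ : E → ℝ := fun x => max (r - ‖p x‖) 0 / (|r - ‖p x‖| + d x)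
  have hden : ∀ x ∈ C, 0 < |r - ‖p x‖| + d x := by
    intro x hx
    rcases eq_or_ne ‖p x‖ r with hpr | hpr
    · refine add_pos_of_nonneg_of_pos (abs_nonneg _) ((hd0 x).lt_of_ne' fun h0 => ?_)
      obtain ⟨μ, hμ, hμx⟩ := (hray.mem_iff_infDist_zero hray0).2 h0
      refine hin x hx hpr μ hμ ?_
      simp only at hμx
      rw [hμx]; abel
    · exact add_pos_of_pos_of_nonneg (abs_pos.2 (sub_ne_zero.2 hpr.symm)) (hd0 x)
  have hφc : ContinuousOn φ C :=
    ContinuousOn.div (by fun_prop) (by fun_prop) fun x hx => (hden x hx).ne'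
  have hφ0 : ∀ x ∈ C, 0 ≤ φ x := fun x hx =>
    div_nonneg (le_max_right _ _) (hden x hx).le
  have hφ1 : ∀ x ∈ C, φ x ≤ 1 := fun x hx => by
    rw [div_le_one (hden x hx)]
    exact (max_le (le_abs_self _) (abs_nonneg _)).trans (le_add_of_nonneg_right (hd0 x))
  have hφout : ∀ x, r ≤ ‖p x‖ → φ x = 0 := fun x hx => by
    simp [φ, max_eq_right (sub_nonpos.2 hx)]
  obtain ⟨M, hM0, hM⟩ : ∃ M : ℝ, 0 ≤ M ∧ r + B < M * ‖h‖ := by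
    refine ⟨(r + |B| + 1) / ‖h‖, by positivity, ?_⟩
    rw [div_mul_cancel₀ _ hhpos.ne']
    linarith [le_abs_self B]
  let N₀ : E → X := fun x => A x + (φ x * M) • h
  let π : X → X := fun y => (R / max R ‖y‖) • y
  have hR : 0 < R := hr.trans hrR
  have hmax : ∀ y : X, 0 < max R ‖y‖ := fun y => lt_max_of_lt_left hR
  have hπ : Continuous π := by
    refine Continuous.smul (Continuous.div (by fun_prop) (by fun_prop) ?_) continuous_id
    exact fun y => (hmax y).ne'
  refine ⟨fun x => π (N₀ x), (fun q : X × ℝ => π (q.1 + q.2 • h)) '' (S ×ˢ Icc 0 M), ?_, ?_, ?_,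
    ?_, ?_⟩
  · exact hπ.comp_continuousOn (by fun_prop)
  · exact (hS.prod isCompact_Icc).image (hπ.comp (by fun_prop))
  · rintro _ ⟨⟨a, t⟩, ⟨ha, ht⟩, rfl⟩
    constructor
    · exact hK.smul_mem (hK.add_mem (hSK ha) (hK.smul_mem hh ht.1)) (div_pos hR (hmax _)).le
    · rw [mem_closedBall_zero_iff, norm_smul, Real.norm_of_nonneg (div_pos hR (hmax _)).le,
        div_mul_eq_mul_div, div_le_iff₀ (hmax _)]
      gcongr
      exact le_max_right _ _
  · intro x hx
    exact ⟨(A x, φ x * M), ⟨hAS hx, mul_nonneg (hφ0 x hx) hM0,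
      mul_le_of_le_one_left hM0 (hφ1 x hx)⟩, rfl⟩
  · intro x hx hfix
    have hfix' : (R / max R ‖N₀ x‖) • N₀ x = p x := hfix
    rcases lt_or_ge R ‖N₀ x‖ with hlt | hle
    · exfalso
      rw [max_eq_right hlt.le] at hfix'
      have hN : 0 < ‖N₀ x‖ := hR.trans hlt
      have hpR : ‖p x‖ = R := by
        rw [← hfix', norm_smul, Real.norm_of_nonneg (by positivity), div_mul_cancel₀ _ hN.ne']
      have hNA : N₀ x = A x := by simp [N₀, hφout x (hpR ▸ hrR.le)]
      refine hout x hx hpR (‖N₀ x‖ / R) ((one_le_div hR).2 hlt.le) ?_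
      rw [← hfix', smul_smul, hNA, div_mul_div_cancel₀ hR.ne', div_self (hNA ▸ hN.ne'), one_smul]
    · rw [max_eq_left hle, div_self hR.ne', one_smul] at hfix'
      rcases le_or_gt r ‖p x‖ with hpr | hpr
      · refine ⟨hpr, ?_⟩
        simpa [N₀, hφout x hpr] using hfix'
      · exfalso
        have hsub : p x - A x = (φ x * M) • h := by rw [← hfix']; simp [N₀]
        have hdx : d x = 0 := (hray.mem_iff_infDist_zero hray0).1
          ⟨φ x * M, mul_nonneg (hφ0 x hx) hM0, hsub.symm⟩
        have hφx : φ x = 1 := by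
          have : 0 < r - ‖p x‖ := sub_pos.2 hpr
          simp only [φ, hdx, add_zero, abs_of_pos this, max_eq_left this.le]
          exact div_self this.ne'
        have h1 : M * ‖h‖ = ‖p x - A x‖ := by
          rw [hsub, hφx, one_mul, norm_smul, Real.norm_of_nonneg hM0]
        linarith [norm_sub_le (p x) (A x), hB _ (hAS hx)]

variable {Y : Type*} [NormedAddCommGroup Y] [NormedSpace ℝ Y] {K₁ : Set X} {K₂ : Set Y}

/-- A compact map on `KrR` which is compressive in both components has a fixed point. -/
theorem exists_fixedPoint_of_compression (hK₁ : IsCone K₁) (hK₂ : IsCone K₂) {r₁ r₂ R₁ R₂ : ℝ}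
    (hr₁ : 0 < r₁) (hR₁ : r₁ < R₁) (hr₂ : 0 < r₂) (hR₂ : r₂ < R₂) {T₁ : X × Y → X}
    {T₂ : X × Y → Y} (hT₁ : ContinuousOn T₁ (KrR K₁ K₂ r₁ r₂ R₁ R₂))
    (hT₂ : ContinuousOn T₂ (KrR K₁ K₂ r₁ r₂ R₁ R₂)) {S₁ : Set X} {S₂ : Set Y}
    (hS₁ : IsCompact S₁) (hS₂ : IsCompact S₂) (hSK₁ : S₁ ⊆ K₁) (hSK₂ : S₂ ⊆ K₂)
    (hTS₁ : MapsTo T₁ (KrR K₁ K₂ r₁ r₂ R₁ R₂) S₁) (hTS₂ : MapsTo T₂ (KrR K₁ K₂ r₁ r₂ R₁ R₂) S₂)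
    {h₁ : X} {h₂ : Y} (hh₁ : h₁ ∈ K₁) (hh₂ : h₂ ∈ K₂) (hn₁ : h₁ ≠ 0) (hn₂ : h₂ ≠ 0)
    (hin₁ : ∀ p ∈ KrR K₁ K₂ r₁ r₂ R₁ R₂, ‖p.1‖ = r₁ → ∀ μ : ℝ, 0 ≤ μ → T₁ p + μ • h₁ ≠ p.1)
    (hout₁ : ∀ p ∈ KrR K₁ K₂ r₁ r₂ R₁ R₂, ‖p.1‖ = R₁ → ∀ l : ℝ, 1 ≤ l → T₁ p ≠ l • p.1)
    (hin₂ : ∀ p ∈ KrR K₁ K₂ r₁ r₂ R₁ R₂, ‖p.2‖ = r₂ → ∀ μ : ℝ, 0 ≤ μ → T₂ p + μ • h₂ ≠ p.2)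
    (hout₂ : ∀ p ∈ KrR K₁ K₂ r₁ r₂ R₁ R₂, ‖p.2‖ = R₂ → ∀ l : ℝ, 1 ≤ l → T₂ p ≠ l • p.2) :
    ∃ p ∈ KrR K₁ K₂ r₁ r₂ R₁ R₂, T₁ p = p.1 ∧ T₂ p = p.2 := by
  obtain ⟨ρ₁, hρ₁, hρm₁, hρr₁⟩ := hK₁.exists_retraction hh₁ hn₁ hr₁
  obtain ⟨ρ₂, hρ₂, hρm₂, hρr₂⟩ := hK₂.exists_retraction hh₂ hn₂ hr₂
  let C : Set (X × Y) := (K₁ ∩ closedBall 0 R₁) ×ˢ (K₂ ∩ closedBall 0 R₂)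
  let q : X × Y → X × Y := fun x => (ρ₁ x.1, ρ₂ x.2)
  have hq : ContinuousOn q C :=
    (hρ₁.comp continuousOn_fst fun x hx => hx.1.1).prodMk
      (hρ₂.comp continuousOn_snd fun x hx => hx.2.1)
  have hqD : MapsTo q C (KrR K₁ K₂ r₁ r₂ R₁ R₂) := by
    rintro x ⟨⟨hx₁, hb₁⟩, hx₂, hb₂⟩
    rw [mem_closedBall_zero_iff] at hb₁ hb₂
    refine ⟨(hρm₁ _ hx₁).1, (hρm₂ _ hx₂).1, ?_, ?_, ?_, ?_⟩
    · exact (le_max_left _ _).trans_eq (hρm₁ _ hx₁).2.symm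
    · exact (hρm₁ _ hx₁).2.trans_le (max_le hR₁.le hb₁)
    · exact (le_max_left _ _).trans_eq (hρm₂ _ hx₂).2.symm
    · exact (hρm₂ _ hx₂).2.trans_le (max_le hR₂.le hb₂)
  have hq₁ : ∀ x : X × Y, r₁ ≤ ‖x.1‖ → (q x).1 = x.1 := fun x hx => hρr₁ _ hx
  have hq₂ : ∀ x : X × Y, r₂ ≤ ‖x.2‖ → (q x).2 = x.2 := fun x hx => hρr₂ _ hx
  obtain ⟨N₁, S₁', hN₁, hS₁', hSC₁, hNS₁, hfix₁⟩ := hK₁.exists_modification_of_compression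
    (C := C) (p := Prod.fst) (A := fun x => T₁ (q x)) hh₁ hn₁ hr₁ hR₁ continuousOn_fst
    (hT₁.comp hq hqD) hS₁ hSK₁ (hTS₁.comp hqD)
    (fun x hx hxr => by
      have e := hq₁ x hxr.ge
      simpa [e] using hin₁ (q x) (hqD hx) (by rw [e, hxr]))
    (fun x hx hxR => by
      have e := hq₁ x (by linarith)
      simpa [e] using hout₁ (q x) (hqD hx) (by rw [e, hxR]))
  obtain ⟨N₂, S₂', hN₂, hS₂', hSC₂, hNS₂, hfix₂⟩ := hK₂.exists_modification_of_compression
    (C := C) (p := Prod.snd) (A := fun x => T₂ (q x)) hh₂ hn₂ hr₂ hR₂ continuousOn_snd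
    (hT₂.comp hq hqD) hS₂ hSK₂ (hTS₂.comp hqD)
    (fun x hx hxr => by
      have e := hq₂ x hxr.ge
      simpa [e] using hin₂ (q x) (hqD hx) (by rw [e, hxr]))
    (fun x hx hxR => by
      have e := hq₂ x (by linarith)
      simpa [e] using hout₂ (q x) (hqD hx) (by rw [e, hxR]))
  have h0₁ : (0 : X) ∈ K₁ := by simpa using hK₁.smul_mem hh₁ le_rfl
  have h0₂ : (0 : Y) ∈ K₂ := by simpa using hK₂.smul_mem hh₂ le_rfl
  obtain ⟨x, hx, hfix⟩ := exists_fixedPoint_of_convex_of_mapsTo_compact (C := C)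
    (f := fun x => (N₁ x, N₂ x))
    ((hK₁.convex_inter_closedBall R₁).prod (hK₂.convex_inter_closedBall R₂))
    ⟨0, ⟨h0₁, mem_closedBall_self (by linarith)⟩, h0₂, mem_closedBall_self (by linarith)⟩
    (hS₁'.prod hS₂') (prod_mono hSC₁ hSC₂) (hN₁.prodMk hN₂) (fun x hx => ⟨hNS₁ hx, hNS₂ hx⟩)
  obtain ⟨hr₁', hA₁⟩ := hfix₁ x hx (congrArg Prod.fst hfix)
  obtain ⟨hr₂', hA₂⟩ := hfix₂ x hx (congrArg Prod.snd hfix)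
  have hqx : q x = x := Prod.ext (hq₁ x hr₁') (hq₂ x hr₂')
  rw [hqx] at hA₁ hA₂
  exact ⟨x, hqx ▸ hqD hx, hA₁, hA₂⟩

/-- Reversing the radius exchanges the two spheres on which compression and expansion conditions
are imposed, so that either condition becomes a compression condition. -/
theorem exists_radial_reparametrization {Ω : Type*} {D : Set Ω} {T p : Ω → X} {h : X} {r R : ℝ}
    (hyp : (∀ x ∈ D, (‖p x‖ = r → ∀ μ : ℝ, 0 ≤ μ → T x + μ • h ≠ p x) ∧
          (‖p x‖ = R → ∀ l : ℝ, 1 ≤ l → T x ≠ l • p x)) ∨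
        (∀ x ∈ D, (‖p x‖ = r → ∀ l : ℝ, 1 ≤ l → T x ≠ l • p x) ∧
          (‖p x‖ = R → ∀ μ : ℝ, 0 ≤ μ → T x + μ • h ≠ p x))) :
    ∃ s : ℝ → ℝ, Continuous s ∧ MapsTo s (Icc r R) (Icc r R) ∧
      (∀ x ∈ D, ‖p x‖ = s r → ∀ μ : ℝ, 0 ≤ μ → T x + μ • h ≠ p x) ∧
      (∀ x ∈ D, ‖p x‖ = s R → ∀ l : ℝ, 1 ≤ l → T x ≠ l • p x) ∧
      ∀ x ∈ D, ‖p x‖ ∈ Icc r R → T x = p x → r < ‖p x‖ ∧ ‖p x‖ < R := by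
  rcases hyp with H | H
  · refine ⟨id, continuous_id, mapsTo_id _, fun x hx => (H x hx).1, fun x hx => (H x hx).2, ?_⟩
    intro x hx hxI hfix
    refine ⟨hxI.1.lt_of_ne' fun e => (H x hx).1 e 0 le_rfl (by simpa using hfix),
      hxI.2.lt_of_ne fun e => (H x hx).2 e 1 le_rfl (by simpa using hfix)⟩
  · refine ⟨fun t => r + R - t, by fun_prop, fun t ht => ⟨by linarith [ht.2], by linarith [ht.1]⟩,
      fun x hx e => (H x hx).2 (by linarith), fun x hx e => (H x hx).1 (by linarith), ?_⟩
    intro x hx hxI hfix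
    refine ⟨hxI.1.lt_of_ne' fun e => (H x hx).1 e 1 le_rfl (by simpa using hfix),
      hxI.2.lt_of_ne fun e => (H x hx).2 e 0 le_rfl (by simpa using hfix)⟩

end Cone

theorem krasnoselskii_precup_strong
    {X Y : Type*} [NormedAddCommGroup X] [NormedSpace ℝ X]
    [NormedAddCommGroup Y] [NormedSpace ℝ Y]
    {K₁ : Set X} {K₂ : Set Y} (hK₁ : IsCone K₁) (hK₂ : IsCone K₂)
    {r₁ r₂ R₁ R₂ : ℝ} (hr₁ : 0 < r₁) (hR₁ : r₁ < R₁) (hr₂ : 0 < r₂) (hR₂ : r₂ < R₂)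
    (T₁ : X × Y → X) (T₂ : X × Y → Y)
    (hmap : ∀ p ∈ KrR K₁ K₂ r₁ r₂ R₁ R₂, T₁ p ∈ K₁ ∧ T₂ p ∈ K₂)
    (hcont : ContinuousOn (fun p => (T₁ p, T₂ p)) (KrR K₁ K₂ r₁ r₂ R₁ R₂))
    (hcpt : IsCompact (closure ((fun p => (T₁ p, T₂ p)) '' (KrR K₁ K₂ r₁ r₂ R₁ R₂))))
    (hyp₁ : ∃ h₁ ∈ K₁, h₁ ≠ 0 ∧
      ((∀ p ∈ KrR K₁ K₂ r₁ r₂ R₁ R₂,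
          (‖p.1‖ = r₁ → ∀ μ : ℝ, 0 ≤ μ → T₁ p + μ • h₁ ≠ p.1) ∧
          (‖p.1‖ = R₁ → ∀ l : ℝ, 1 ≤ l → T₁ p ≠ l • p.1)) ∨
       (∀ p ∈ KrR K₁ K₂ r₁ r₂ R₁ R₂,
          (‖p.1‖ = r₁ → ∀ l : ℝ, 1 ≤ l → T₁ p ≠ l • p.1) ∧
          (‖p.1‖ = R₁ → ∀ μ : ℝ, 0 ≤ μ → T₁ p + μ • h₁ ≠ p.1))))
    (hyp₂ : ∃ h₂ ∈ K₂, h₂ ≠ 0 ∧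
      ((∀ p ∈ KrR K₁ K₂ r₁ r₂ R₁ R₂,
          (‖p.2‖ = r₂ → ∀ μ : ℝ, 0 ≤ μ → T₂ p + μ • h₂ ≠ p.2) ∧
          (‖p.2‖ = R₂ → ∀ l : ℝ, 1 ≤ l → T₂ p ≠ l • p.2)) ∨
       (∀ p ∈ KrR K₁ K₂ r₁ r₂ R₁ R₂,
          (‖p.2‖ = r₂ → ∀ l : ℝ, 1 ≤ l → T₂ p ≠ l • p.2) ∧
          (‖p.2‖ = R₂ → ∀ μ : ℝ, 0 ≤ μ → T₂ p + μ • h₂ ≠ p.2)))) :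
    ∃ p ∈ KrR K₁ K₂ r₁ r₂ R₁ R₂,
      (T₁ p = p.1 ∧ T₂ p = p.2) ∧
      r₁ < ‖p.1‖ ∧ ‖p.1‖ < R₁ ∧ r₂ < ‖p.2‖ ∧ ‖p.2‖ < R₂ := by
  obtain ⟨h₁, hh₁, hn₁, H₁⟩ := hyp₁
  obtain ⟨h₂, hh₂, hn₂, H₂⟩ := hyp₂
  obtain ⟨s₁, hs₁, hsI₁, hin₁, hout₁, hst₁⟩ :=
    exists_radial_reparametrization (p := Prod.fst) H₁
  obtain ⟨s₂, hs₂, hsI₂, hin₂, hout₂, hst₂⟩ :=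
    exists_radial_reparametrization (p := Prod.snd) H₂
  set D := KrR K₁ K₂ r₁ r₂ R₁ R₂ with hD
  let a₁ : X × Y → ℝ := fun x => s₁ ‖x.1‖ / ‖x.1‖
  let a₂ : X × Y → ℝ := fun x => s₂ ‖x.2‖ / ‖x.2‖
  let σ : X × Y → X × Y := fun x => (a₁ x • x.1, a₂ x • x.2)
  have hI₁ : ∀ x ∈ D, ‖x.1‖ ∈ Icc r₁ R₁ := fun x hx => ⟨hx.2.2.1, hx.2.2.2.1⟩
  have hI₂ : ∀ x ∈ D, ‖x.2‖ ∈ Icc r₂ R₂ := fun x hx => ⟨hx.2.2.2.2.1, hx.2.2.2.2.2⟩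
  have hx₁ : ∀ x ∈ D, 0 < ‖x.1‖ := fun x hx => hr₁.trans_le (hI₁ x hx).1
  have hx₂ : ∀ x ∈ D, 0 < ‖x.2‖ := fun x hx => hr₂.trans_le (hI₂ x hx).1
  have ha₁ : ∀ x ∈ D, 0 < a₁ x := fun x hx =>
    div_pos (hr₁.trans_le (hsI₁ (hI₁ x hx)).1) (hx₁ x hx)
  have ha₂ : ∀ x ∈ D, 0 < a₂ x := fun x hx =>
    div_pos (hr₂.trans_le (hsI₂ (hI₂ x hx)).1) (hx₂ x hx)
  have hac₁ : ContinuousOn a₁ D :=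
    ContinuousOn.div (by fun_prop) (by fun_prop) fun x hx => (hx₁ x hx).ne'
  have hac₂ : ContinuousOn a₂ D :=
    ContinuousOn.div (by fun_prop) (by fun_prop) fun x hx => (hx₂ x hx).ne'
  have hσn₁ : ∀ x ∈ D, ‖(σ x).1‖ = s₁ ‖x.1‖ := fun x hx => by
    rw [norm_smul, Real.norm_of_nonneg (ha₁ x hx).le, div_mul_cancel₀ _ (hx₁ x hx).ne']
  have hσn₂ : ∀ x ∈ D, ‖(σ x).2‖ = s₂ ‖x.2‖ := fun x hx => by
    rw [norm_smul, Real.norm_of_nonneg (ha₂ x hx).le, div_mul_cancel₀ _ (hx₂ x hx).ne']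
  have hσ : MapsTo σ D D := by
    intro x hx
    refine ⟨hK₁.smul_mem hx.1 (ha₁ x hx).le, hK₂.smul_mem hx.2.1 (ha₂ x hx).le, ?_⟩
    rw [hσn₁ x hx, hσn₂ x hx]
    have h1 := hsI₁ (hI₁ x hx)
    have h2 := hsI₂ (hI₂ x hx)
    exact ⟨h1.1, h1.2, h2.1, h2.2⟩
  have hσc : ContinuousOn σ D := by fun_prop
  -- the conjugated map and its compactness
  have hTσ : ContinuousOn (fun x => (T₁ (σ x), T₂ (σ x))) D := hcont.comp hσc hσ
  let Q := closure ((fun p => (T₁ p, T₂ p)) '' D)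
  have hQ : ∀ x ∈ D, (T₁ (σ x), T₂ (σ x)) ∈ Q := fun x hx =>
    subset_closure ⟨σ x, hσ hx, rfl⟩
  have hQ₁ : IsCompact ((fun q : ℝ × X => q.1 • q.2) '' (Icc 0 (R₁ / r₁) ×ˢ (Prod.fst '' Q)) ∩ K₁) :=
    ((isCompact_Icc.prod (hcpt.image continuous_fst)).image (by fun_prop)).inter_right hK₁.2.1
  have hQ₂ : IsCompact ((fun q : ℝ × Y => q.1 • q.2) '' (Icc 0 (R₂ / r₂) ×ˢ (Prod.snd '' Q)) ∩ K₂) :=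
    ((isCompact_Icc.prod (hcpt.image continuous_snd)).image (by fun_prop)).inter_right hK₂.2.1
  have hb₁ : ∀ x ∈ D, (a₁ x)⁻¹ ∈ Icc 0 (R₁ / r₁) := fun x hx => by
    refine ⟨(inv_pos.2 (ha₁ x hx)).le, ?_⟩
    rw [inv_div]
    exact div_le_div₀ (by linarith) (hI₁ x hx).2 hr₁ (hsI₁ (hI₁ x hx)).1
  have hb₂ : ∀ x ∈ D, (a₂ x)⁻¹ ∈ Icc 0 (R₂ / r₂) := fun x hx => by
    refine ⟨(inv_pos.2 (ha₂ x hx)).le, ?_⟩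
    rw [inv_div]
    exact div_le_div₀ (by linarith) (hI₂ x hx).2 hr₂ (hsI₂ (hI₂ x hx)).1
  obtain ⟨x, hx, hf₁, hf₂⟩ := exists_fixedPoint_of_compression hK₁ hK₂ hr₁ hR₁ hr₂ hR₂
    (T₁ := fun x => (a₁ x)⁻¹ • T₁ (σ x)) (T₂ := fun x => (a₂ x)⁻¹ • T₂ (σ x))
    ((hac₁.inv₀ fun x hx => (ha₁ x hx).ne').smul (continuous_fst.comp_continuousOn hTσ))
    ((hac₂.inv₀ fun x hx => (ha₂ x hx).ne').smul (continuous_snd.comp_continuousOn hTσ))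
    hQ₁ hQ₂ inter_subset_right inter_subset_right
    (fun x hx => ⟨⟨((a₁ x)⁻¹, T₁ (σ x)), ⟨hb₁ x hx, _, hQ x hx, rfl⟩, rfl⟩,
      hK₁.smul_mem (hmap _ (hσ hx)).1 (hb₁ x hx).1⟩)
    (fun x hx => ⟨⟨((a₂ x)⁻¹, T₂ (σ x)), ⟨hb₂ x hx, _, hQ x hx, rfl⟩, rfl⟩,
      hK₂.smul_mem (hmap _ (hσ hx)).2 (hb₂ x hx).1⟩)
    hh₁ hh₂ hn₁ hn₂
    (fun x hx hxr μ hμ e => by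
      refine hin₁ (σ x) (hσ hx) (by rw [hσn₁ x hx, hxr]) (a₁ x * μ)
        (mul_nonneg (ha₁ x hx).le hμ) ?_
      change _ = a₁ x • x.1
      rw [← e, smul_add, smul_inv_smul₀ (ha₁ x hx).ne', mul_smul])
    (fun x hx hxR l hl e => by
      refine hout₁ (σ x) (hσ hx) (by rw [hσn₁ x hx, hxR]) l hl ?_
      change _ = l • a₁ x • x.1
      rw [smul_comm, ← e, smul_inv_smul₀ (ha₁ x hx).ne'])
    (fun x hx hxr μ hμ e => by
      refine hin₂ (σ x) (hσ hx) (by rw [hσn₂ x hx, hxr]) (a₂ x * μ)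
        (mul_nonneg (ha₂ x hx).le hμ) ?_
      change _ = a₂ x • x.2
      rw [← e, smul_add, smul_inv_smul₀ (ha₂ x hx).ne', mul_smul])
    (fun x hx hxR l hl e => by
      refine hout₂ (σ x) (hσ hx) (by rw [hσn₂ x hx, hxR]) l hl ?_
      change _ = l • a₂ x • x.2
      rw [smul_comm, ← e, smul_inv_smul₀ (ha₂ x hx).ne'])
  have hfix₁ : T₁ (σ x) = (σ x).1 := ((inv_smul_eq_iff₀ (ha₁ x hx).ne').1 hf₁)
  have hfix₂ : T₂ (σ x) = (σ x).2 := ((inv_smul_eq_iff₀ (ha₂ x hx).ne').1 hf₂)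
  have hl₁ := hst₁ (σ x) (hσ hx) (hI₁ _ (hσ hx)) hfix₁
  have hl₂ := hst₂ (σ x) (hσ hx) (hI₂ _ (hσ hx)) hfix₂
  exact ⟨σ x, hσ hx, ⟨hfix₁, hfix₂⟩, hl₁.1, hl₁.2, hl₂.1, hl₂.2⟩
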